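/- Suppose 0 < γ_c < 1 and λ_L − (1/2)μ‖p‖₁²λ_U² > 0, and suppose the blocks z_1,…,z_N ∈ ℝ^M satisfy ‖z_k‖² ≤ λ_U²‖B‖_∞² Σ_{l=1}^{N−1}‖w_{e,l}‖² for every k. Then for all x, y ∈ ℝ^M: ‖T_c(x) − T_c(y) − μ·Σ_{k=1}^N p_k z_k‖² ≤ γ_c·‖x − y‖² + [μ·‖p‖₁²·λ_U²·‖B‖_∞² / (λ_L − (1/2)μ‖p‖₁²λ_U²)]·Σ_{l=1}^{N−1}‖w_{e,l}‖². -/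

import Mathlib

open scoped RealInnerProductSpace

noncomputable section

/-- Maximum absolute row sum of a matrix (the `‖·‖_∞` induced norm). -/
def maxRowSum {n m : ℕ} (B : Matrix (Fin n) (Fin m) ℝ) : ℝ := ⨆ k, ∑ l, |B k l|

/-- Jensen's inequality for the squared norm of a difference, with weights `g` and `1 - g`. -/
theorem norm_sub_sq_le_div_add_div {E : Type*} [SeminormedAddCommGroup E] (a b : E) {g : ℝ}
    (hg0 : 0 < g) (hg1 : g < 1) :
    ‖a - b‖ ^ 2 ≤ ‖a‖ ^ 2 / g + ‖b‖ ^ 2 / (1 - g) := by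
  have hg1' : 0 < 1 - g := sub_pos.2 hg1
  calc ‖a - b‖ ^ 2 ≤ (‖a‖ + ‖b‖) ^ 2 := by gcongr; exact norm_sub_le a b
    _ ≤ ‖a‖ ^ 2 / g + ‖b‖ ^ 2 / (1 - g) := by
      rw [div_add_div _ _ hg0.ne' hg1'.ne', le_div_iff₀ (by positivity)]
      nlinarith [sq_nonneg ((1 - g) * ‖a‖ - g * ‖b‖)]

theorem norm_sum_smul_le_sum_mul {ι E : Type*} [Fintype ι] [SeminormedAddCommGroup E]
    [NormedSpace ℝ E] {p : ι → ℝ} (hp : ∀ k, 0 ≤ p k) {v : ι → E} {c : ℝ}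
    (hv : ∀ k, ‖v k‖ ≤ c) :
    ‖∑ k, p k • v k‖ ≤ (∑ k, p k) * c := by
  rw [Finset.sum_mul]
  refine norm_sum_le_of_le _ fun k _ => ?_
  rw [norm_smul, Real.norm_of_nonneg (hp k)]
  exact mul_le_mul_of_nonneg_left (hv k) (hp k)

/-- A gradient-type step along a strongly monotone, bounded direction contracts squared norms. -/
theorem norm_sub_smul_sq_le {E : Type*} [NormedAddCommGroup E] [InnerProductSpace ℝ E]
    {d G : E} {m L μ : ℝ} (hμ : 0 ≤ μ) (hm : m * ‖d‖ ^ 2 ≤ ⟪d, G⟫) (hL : ‖G‖ ≤ L * ‖d‖) :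
    ‖d - μ • G‖ ^ 2 ≤ (1 - μ * m + (1 / 2) * μ ^ 2 * L ^ 2) ^ 2 * ‖d‖ ^ 2 := by
  have hG : ‖G‖ ^ 2 ≤ (L * ‖d‖) ^ 2 := by gcongr
  rw [norm_sub_sq_real, real_inner_smul_right, norm_smul, mul_pow, Real.norm_of_nonneg hμ]
  nlinarith [mul_le_mul_of_nonneg_left hm hμ, mul_le_mul_of_nonneg_left hG (sq_nonneg μ),
    mul_nonneg (sq_nonneg (-(μ * m) + (1 / 2) * μ ^ 2 * L ^ 2)) (sq_nonneg ‖d‖)]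

/-- Second-power contraction bound for the centralized operator
`T_c(w) = w - μ ∑ₖ p_k s_k(w)` perturbed by the blocks `z_k`. -/
theorem Tc_z_second_bound
    (N M : ℕ)
    (s : Fin N → EuclideanSpace ℝ (Fin M) → EuclideanSpace ℝ (Fin M))
    (lamU lamL μ : ℝ) (hlamL : 0 < lamL) (hμ : 0 < μ)
    (p : Fin N → ℝ) (hp : ∀ k, 0 < p k)
    (hLip : ∀ k x y, ‖s k x - s k y‖ ≤ lamU * ‖x - y‖)
    (hmono : ∀ x y : EuclideanSpace ℝ (Fin M),
      lamL * ‖x - y‖ ^ 2 ≤ ⟪x - y, ∑ k, p k • (s k x - s k y)⟫)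
    (hγ0 : 0 < 1 - μ * lamL + (1 / 2) * μ ^ 2 * (∑ k, p k) ^ 2 * lamU ^ 2)
    (hγ1 : 1 - μ * lamL + (1 / 2) * μ ^ 2 * (∑ k, p k) ^ 2 * lamU ^ 2 < 1)
    (hden : 0 < lamL - (1 / 2) * μ * (∑ k, p k) ^ 2 * lamU ^ 2)
    (B : Matrix (Fin N) (Fin (N - 1)) ℝ)
    (we : Fin (N - 1) → EuclideanSpace ℝ (Fin M))
    (z : Fin N → EuclideanSpace ℝ (Fin M))
    (hz : ∀ k, ‖z k‖ ^ 2 ≤ lamU ^ 2 * maxRowSum B ^ 2 * ∑ l, ‖we l‖ ^ 2) :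
    ∀ x y : EuclideanSpace ℝ (Fin M),
      ‖(x - μ • ∑ k, p k • s k x) - (y - μ • ∑ k, p k • s k y) - μ • ∑ k, p k • z k‖ ^ 2
        ≤ (1 - μ * lamL + (1 / 2) * μ ^ 2 * (∑ k, p k) ^ 2 * lamU ^ 2) * ‖x - y‖ ^ 2
          + μ * (∑ k, p k) ^ 2 * lamU ^ 2 * maxRowSum B ^ 2
              / (lamL - (1 / 2) * μ * (∑ k, p k) ^ 2 * lamU ^ 2)
            * ∑ l, ‖we l‖ ^ 2 := by
  intro x y
  set P := ∑ k, p k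
  set W := ∑ l, ‖we l‖ ^ 2
  set g := 1 - μ * lamL + (1 / 2) * μ ^ 2 * P ^ 2 * lamU ^ 2 with hg
  set D := lamL - (1 / 2) * μ * P ^ 2 * lamU ^ 2 with hD
  have hW : 0 ≤ W := Finset.sum_nonneg fun l _ => sq_nonneg _
  have hp' : ∀ k, 0 ≤ p k := fun k => (hp k).le
  have hgD : 1 - g = μ * D := by rw [hg, hD]; ring
  have hstep : (x - μ • ∑ k, p k • s k x) - (y - μ • ∑ k, p k • s k y)
      = (x - y) - μ • ∑ k, p k • (s k x - s k y) := by
    simp only [smul_sub, Finset.sum_sub_distrib]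
    abel
  have hcontr : ‖(x - y) - μ • ∑ k, p k • (s k x - s k y)‖ ^ 2 ≤ g ^ 2 * ‖x - y‖ ^ 2 := by
    have hG := norm_sum_smul_le_sum_mul hp' fun k => hLip k x y
    rw [← mul_assoc] at hG
    have h := norm_sub_smul_sq_le hμ.le (hmono x y) hG
    rwa [mul_pow P lamU, ← mul_assoc] at h
  have hZ : ‖∑ k, p k • z k‖ ^ 2 ≤ P ^ 2 * (lamU ^ 2 * maxRowSum B ^ 2 * W) := by
    have h := norm_sum_smul_le_sum_mul hp' fun k => Real.le_sqrt_of_sq_le (hz k)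
    calc ‖∑ k, p k • z k‖ ^ 2 ≤ (P * √(lamU ^ 2 * maxRowSum B ^ 2 * W)) ^ 2 := by gcongr
      _ = _ := by rw [mul_pow, Real.sq_sqrt (by positivity)]
  rw [hstep]
  refine (norm_sub_sq_le_div_add_div _ _ hγ0 hγ1).trans (add_le_add ?_ ?_)
  · rw [div_le_iff₀ hγ0]
    exact hcontr.trans_eq (by ring)
  · rw [hgD, norm_smul, mul_pow, Real.norm_of_nonneg hμ.le]
    calc μ ^ 2 * ‖∑ k, p k • z k‖ ^ 2 / (μ * D)
        ≤ μ ^ 2 * (P ^ 2 * (lamU ^ 2 * maxRowSum B ^ 2 * W)) / (μ * D) := by gcongr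
      _ = μ * P ^ 2 * lamU ^ 2 * maxRowSum B ^ 2 / D * W := by
        field_simp

end
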